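/- arXiv:1909.00440 — 2 statements merged into one kernel-verified Lean document; each statement's English description precedes it below -/
import Mathlib

section
/- Let λ > 0, let δ ≥ 1, and let M be a Poisson(λ) random variable. Then E[ 1/(M + δ) ] ≤ (1 − e^{−(λ+δ−1)}) / (λ + δ − 1). -/
open Finset in
/-- The partial sums of `∑ lam ^ n * e ^ (-lam) / n! * x ^ (n + δ - 1)` are bounded by an
exponential in `x`. -/
lemma sum_poisson_mul_rpow_le {lam δ x : ℝ} (hlam : 0 ≤ lam) (hδ : 1 ≤ δ) (hx : 0 < x) (N : ℕ) :
    ∑ n ∈ range N, lam ^ n * Real.exp (-lam) / n.factorial * x ^ ((n : ℝ) + δ - 1)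
      ≤ Real.exp ((lam + δ - 1) * x - (lam + δ - 1)) := by
  have hpow : x ^ (δ - 1) ≤ Real.exp ((δ - 1) * x - (δ - 1)) := by
    rw [Real.rpow_def_of_pos hx]
    apply Real.exp_le_exp.mpr
    nlinarith [mul_le_mul_of_nonneg_right (Real.log_le_sub_one_of_pos hx) (sub_nonneg.mpr hδ)]
  calc
    _ = Real.exp (-lam) * (∑ n ∈ range N, (lam * x) ^ n / n.factorial) * x ^ (δ - 1) := by
      rw [mul_sum, sum_mul]
      refine sum_congr rfl fun n _ ↦ ?_
      rw [add_sub_assoc, Real.rpow_add hx, Real.rpow_natCast, mul_pow]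
      ring
    _ ≤ Real.exp (-lam) * Real.exp (lam * x) * Real.exp ((δ - 1) * x - (δ - 1)) := by
      gcongr
      exact Real.sum_le_exp_of_nonneg (by positivity) N
    _ = _ := by
      rw [← Real.exp_add, ← Real.exp_add]
      ring_nf

lemma integral_exp_mul_sub_self {c : ℝ} (hc : c ≠ 0) :
    ∫ x in (0 : ℝ)..1, Real.exp (c * x - c) = (1 - Real.exp (-c)) / c := by
  rw [intervalIntegral.integral_comp_mul_sub _ hc]
  simp [div_eq_inv_mul]

/-- For a Poisson(λ) random variable `M` and `δ ≥ 1`,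
`E[1/(M+δ)] ≤ (1 - e^{-(λ+δ-1)})/(λ+δ-1)`. -/
theorem stmt_8 (lam : ℝ) (hlam : 0 < lam) (δ : ℝ) (hδ : 1 ≤ δ) :
    ∑' n : ℕ, lam ^ n * Real.exp (-lam) / n.factorial * (1 / (n + δ))
      ≤ (1 - Real.exp (-(lam + δ - 1))) / (lam + δ - 1) := by
  have hexp (n : ℕ) : 0 ≤ (n : ℝ) + δ - 1 := by
    linarith [Nat.cast_nonneg (α := ℝ) n]
  have hint (n : ℕ) : ∫ x in (0 : ℝ)..1, x ^ ((n : ℝ) + δ - 1) = 1 / (n + δ) := by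
    have := hexp n
    rw [integral_rpow (Or.inl (by linarith)), sub_add_cancel, Real.one_rpow,
      Real.zero_rpow (by linarith), sub_zero]
  have hintble (n : ℕ) : IntervalIntegrable
      (fun x : ℝ ↦ lam ^ n * Real.exp (-lam) / n.factorial * x ^ ((n : ℝ) + δ - 1))
      MeasureTheory.volume 0 1 :=
    (intervalIntegral.intervalIntegrable_rpow' (by linarith [hexp n])).const_mul _
  refine Real.tsum_le_of_sum_range_le (fun n ↦ by positivity) fun N ↦ ?_
  simp_rw [← hint, ← intervalIntegral.integral_const_mul]
  rw [← intervalIntegral.integral_finsetSum fun n _ ↦ hintble n,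
    ← integral_exp_mul_sub_self (by linarith)]
  refine intervalIntegral.integral_mono_on_of_le_Ioo zero_le_one ?_
    (Continuous.intervalIntegrable (by fun_prop) _ _)
    fun x hx ↦ sum_poisson_mul_rpow_le hlam.le hδ hx.1 N
  simpa only [Finset.sum_fn] using IntervalIntegrable.sum (Finset.range N) fun n _ ↦ hintble n
end

section
/- Let 0 < σ < ρ < 1 and let a > 0 be a real number such that a(1−ρ)/(ρ−σ) is not a positive integer. Then inf over positive integers N of d_KL( (σN + a)/(N + a), ρ ) is strictly positive, where d_KL(x, y) = x·log(x/y) + (1−x)·log((1−x)/(1−y)) for x, y ∈ (0,1). -/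
/-- The binary Kullback–Leibler divergence. -/
noncomputable def dKL (x y : ℝ) : ℝ :=
  x * Real.log (x / y) + (1 - x) * Real.log ((1 - x) / (1 - y))

lemma two_mul_sub_two_mul_sqrt_mul_le_mul_log_div {x y : ℝ} (hx : 0 < x) (hy : 0 < y) :
    2 * x - 2 * (√x * √y) ≤ x * Real.log (x / y) := by
  have hsx := Real.sqrt_pos.2 hx
  have hsy := Real.sqrt_pos.2 hy
  have hlog := Real.log_le_sub_one_of_pos (div_pos hsy hsx)
  have hdiv : x / y = ((√y / √x) ^ 2)⁻¹ := by
    rw [div_pow, Real.sq_sqrt hx.le, Real.sq_sqrt hy.le, inv_div]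
  have hmul : x * (√y / √x) = √x * √y := by
    nth_rewrite 1 [← Real.mul_self_sqrt hx.le]
    field_simp
  rw [hdiv, Real.log_inv, Real.log_pow]
  push_cast
  nlinarith [mul_le_mul_of_nonneg_left hlog hx.le]

/-- A quadratic lower bound for the binary Kullback–Leibler divergence. -/
lemma sq_sub_div_four_le_dKL {x y : ℝ} (hx0 : 0 < x) (hx1 : x < 1) (hy0 : 0 < y) (hy1 : y < 1) :
    (x - y) ^ 2 / 4 ≤ dKL x y := by
  have h₁ := two_mul_sub_two_mul_sqrt_mul_le_mul_log_div hx0 hy0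
  have h₂ := two_mul_sub_two_mul_sqrt_mul_le_mul_log_div (sub_pos.2 hx1) (sub_pos.2 hy1)
  have hx := Real.sq_sqrt hx0.le
  have hy := Real.sq_sqrt hy0.le
  have hx' := Real.sq_sqrt (sub_pos.2 hx1).le
  have hy' := Real.sq_sqrt (sub_pos.2 hy1).le
  have hsum : (√x + √y) ^ 2 ≤ 4 := by nlinarith [sq_nonneg (√x - √y)]
  have hsq : (x - y) ^ 2 = (√x + √y) ^ 2 * (√x - √y) ^ 2 := by
    rw [← mul_pow, ← sq_sub_sq, hx, hy]
  have hmul := mul_le_mul_of_nonneg_right hsum (sq_nonneg (√x - √y))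
  unfold dKL
  nlinarith [sq_nonneg (√(1 - x) - √(1 - y))]

/-- If `0 < σ < ρ < 1`, `a > 0`, and `a(1-ρ)/(ρ-σ)` is not a positive integer, then
`inf_{N ∈ ℕ⁺} d_KL((σN + a)/(N + a), ρ) > 0`. -/
theorem stmt_13 (σ ρ a : ℝ) (hσ : 0 < σ) (hσρ : σ < ρ) (hρ : ρ < 1) (ha : 0 < a)
    (hirr : ¬∃ k : ℕ, 0 < k ∧ a * (1 - ρ) / (ρ - σ) = k) :
    0 < ⨅ N : ℕ+, dKL ((σ * (N : ℕ) + a) / ((N : ℕ) + a)) ρ := by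
  have hd : 0 < ρ - σ := sub_pos.2 hσρ
  set c := a * (1 - ρ) / (ρ - σ) with hc
  have hc0 : 0 < c := div_pos (mul_pos ha (sub_pos.2 hρ)) hd
  have hcd : c * (ρ - σ) = a * (1 - ρ) := div_mul_cancel₀ _ hd.ne'
  set η := |c - round c| with hη
  have hη0 : 0 < η := by
    refine abs_pos.2 fun h => hirr ?_
    have hcr := sub_eq_zero.1 h
    generalize round c = r at hcr
    have hr : 0 < r := by
      rw [hcr] at hc0
      exact_mod_cast hc0
    lift r to ℕ using hr.le
    exact ⟨r, by exact_mod_cast hr, by rw [hcr, Int.cast_natCast]⟩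
  set δ := (ρ - σ) * (η / (η + c + a)) with hδ
  have hδ0 : 0 < δ := by positivity
  refine lt_of_lt_of_le (show (0 : ℝ) < δ ^ 2 / 4 by positivity) (le_ciInf fun N => ?_)
  have hN : (0 : ℝ) < (N : ℕ) := by exact_mod_cast N.pos
  generalize hn : ((N : ℕ) : ℝ) = n at hN ⊢
  have hna : 0 < n + a := by positivity
  have hηn : η ≤ |c - n| := by
    have h := round_le c ((N : ℕ) : ℤ)
    rwa [Int.cast_natCast, hn] at h
  refine le_trans ?_ (sq_sub_div_four_le_dKL (by positivity) ?_ (hσ.trans hσρ) hρ)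
  · have heq : (σ * n + a) / (n + a) - ρ = (ρ - σ) * (c - n) / (n + a) := by
      rw [eq_div_iff hna.ne', sub_mul, div_mul_cancel₀ _ hna.ne']
      linear_combination -hcd
    have hle : δ ≤ |(σ * n + a) / (n + a) - ρ| := by
      rw [heq, abs_div, abs_mul, abs_of_pos hd, abs_of_pos hna, hδ, mul_div_assoc]
      refine mul_le_mul_of_nonneg_left ?_ hd.le
      rw [div_le_div_iff₀ (by positivity) hna]
      have hnc : n ≤ |c - n| + c := by linarith [neg_abs_le (c - n)]
      nlinarith [mul_le_mul_of_nonneg_left hnc hη0.le,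
        mul_le_mul_of_nonneg_right hηn (add_pos hc0 ha).le]
    rw [← sq_abs ((σ * n + a) / (n + a) - ρ)]
    gcongr
  · rw [div_lt_one hna]
    nlinarith
end
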